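/- arXiv:1711.08216 — 2 statements merged into one kernel-verified Lean document; each statement's English description precedes it below -/
import Mathlib

section
/- Suppose q ≡ 1 (mod 8) and p ≡ 5 (mod 8). Then the linear complexity of the quaternary sequence (e_u) is L((e_u)) = q + 3(p-1)(q-1)/4 if 2 mod pq ∈ D_0, and L((e_u)) = pq - p + 1 if 2 mod pq ∈ D_2. -/
/-- A local ring of Galois-ring type with a faithful additive character of `ZMod n`. -/
structure GD (n : ℕ) (G k : Type) [CommRing G] [Field k] where
  φ : ZMod 4 →+* G
  π : G →+* k
  σ : G →+* G
  lift : ∀ x, π x = 0 → ∃ y, x = 2 * y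
  two_mul : ∀ y, 2 * y = 0 → π y = 0
  unit : ∀ x, π x ≠ 0 → IsUnit x
  frob : ∀ x, π (σ x) = π x ^ 2
  χ : AddChar (ZMod n) G
  sig : ∀ x, σ (χ x) = χ (2 * x)
  prim : ∀ x, π (χ x) = 1 → x = 0

theorem exists_GD (n : ℕ) (hn : Odd n) :
    ∃ (G k : Type) (_ : CommRing G) (_ : Field k), Nonempty (GD n G k) := by
  have hn0 : n ≠ 0 := by rintro rfl; simp at hn
  have : NeZero n := ⟨hn0⟩
  let k := AlgebraicClosure (ZMod 2)
  have : CharP k 2 := charP_of_injective_algebraMap (algebraMap (ZMod 2) k).injective 2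
  have hnk : ((n : ℕ) : k) ≠ 0 := by
    rw [Ne, CharP.cast_eq_zero_iff k 2]
    intro h; exact (Nat.not_even_iff_odd.mpr hn) (even_iff_two_dvd.mpr h)
  have : NeZero ((n : ℕ) : k) := ⟨hnk⟩
  obtain ⟨z, hz⟩ := HasEnoughRootsOfUnity.exists_primitiveRoot k n
  let W := WittVector 2 k
  let I : Ideal W := Ideal.span {(4 : W)}
  have h2W : (WittVector.constantCoeff (2 : W) : k) = 0 := by
    rw [map_ofNat]; exact CharP.cast_eq_zero k 2
  have hpi : ∀ a ∈ I, (WittVector.constantCoeff : W →+* k) a = 0 := by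
    intro a ha
    obtain ⟨b, rfl⟩ := Ideal.mem_span_singleton.mp ha
    have : (4 : W) = 2 * 2 := by norm_num
    rw [this, map_mul, map_mul, h2W]; simp
  have hsi : ∀ a ∈ I, ((Ideal.Quotient.mk I).comp (WittVector.frobenius : W →+* W)) a = 0 := by
    intro a ha
    obtain ⟨b, rfl⟩ := Ideal.mem_span_singleton.mp ha
    rw [map_mul, map_ofNat]
    have : (OfNat.ofNat 4 : W ⧸ I) = Ideal.Quotient.mk I 4 := by rw [map_ofNat]
    rw [this, Ideal.Quotient.eq_zero_iff_mem.mpr (Ideal.mem_span_singleton_self _), zero_mul]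
  have : Fact (Nat.Prime 2) := ⟨Nat.prime_two⟩
  have h4 : ((4 : ℕ) : W ⧸ I) = 0 := by
    have : ((4 : ℕ) : W ⧸ I) = Ideal.Quotient.mk I 4 := by rw [map_ofNat]; rfl
    rw [this, Ideal.Quotient.eq_zero_iff_mem.mpr (Ideal.mem_span_singleton_self _)]
  have hζ : (Ideal.Quotient.mk I (WittVector.teichmuller 2 z)) ^ n = 1 := by
    rw [← map_pow, ← map_pow, hz.pow_eq_one, map_one, map_one]
  have hfr : (WittVector.frobenius (WittVector.teichmuller 2 z) : W) = (WittVector.teichmuller 2 z) ^ 2 := by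
    rw [← map_pow]
    ext m
    rw [WittVector.coeff_frobenius_charP]
    rcases Nat.eq_zero_or_pos m with rfl | hm
    · rw [WittVector.teichmuller_coeff_zero, WittVector.teichmuller_coeff_zero]
    · rw [WittVector.teichmuller_coeff_pos _ _ _ hm, WittVector.teichmuller_coeff_pos _ _ _ hm]; simp
  refine ⟨W ⧸ I, k, inferInstance, inferInstance, ⟨{
    φ :=
      (Ideal.Quotient.lift (Ideal.span {((4 : ℕ) : ℤ)}) (Int.castRingHom (W ⧸ I)) (by
        intro a ha
        obtain ⟨b, rfl⟩ := Ideal.mem_span_singleton.mp ha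
        rw [map_mul, map_natCast, h4, zero_mul])).comp
        (Int.quotientSpanNatEquivZMod 4).symm.toRingHom
    π := Ideal.Quotient.lift I WittVector.constantCoeff hpi
    σ := Ideal.Quotient.lift I ((Ideal.Quotient.mk I).comp WittVector.frobenius) hsi
    χ := AddChar.zmodChar n hζ
    lift := ?_, two_mul := ?_, unit := ?_, frob := ?_, sig := ?_, prim := ?_ }⟩⟩
  · intro x hx
    obtain ⟨w, rfl⟩ := Ideal.Quotient.mk_surjective x
    rw [Ideal.Quotient.lift_mk] at hx
    have := (WittVector.mem_span_p_iff_coeff_zero_eq_zero (p := 2) w).mpr hx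
    obtain ⟨b, rfl⟩ := Ideal.mem_span_singleton.mp this
    exact ⟨Ideal.Quotient.mk I b, by rw [map_mul, map_natCast]; rfl⟩
  · intro x hx
    obtain ⟨w, rfl⟩ := Ideal.Quotient.mk_surjective x
    rw [Ideal.Quotient.lift_mk]
    have h1 : Ideal.Quotient.mk I (2 * w) = 0 := by rw [map_mul, map_ofNat]; exact hx
    obtain ⟨b, hb⟩ := Ideal.mem_span_singleton.mp (Ideal.Quotient.eq_zero_iff_mem.mp h1)
    have h2 : (2 : W) ≠ 0 := by
      have := WittVector.p_nonzero 2 k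
      exact_mod_cast this
    have : w = 2 * b := mul_left_cancel₀ h2 (by rw [hb]; ring)
    rw [this, map_mul, h2W, zero_mul]
  · intro x hx
    obtain ⟨w, rfl⟩ := Ideal.Quotient.mk_surjective x
    rw [Ideal.Quotient.lift_mk] at hx
    exact (WittVector.isUnit_of_coeff_zero_ne_zero w hx).map _
  · intro x
    obtain ⟨w, rfl⟩ := Ideal.Quotient.mk_surjective x
    simp only [Ideal.Quotient.lift_mk, RingHom.comp_apply]
    exact WittVector.coeff_frobenius_charP 2 w 0
  · intro x
    have h2 : (2 * x : ZMod n) = ((2 * x.val : ℕ) : ZMod n) := by simp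
    rw [h2, AddChar.zmodChar_apply', AddChar.zmodChar_apply, map_pow, Ideal.Quotient.lift_mk,
      RingHom.comp_apply, hfr, map_pow, pow_mul]
  · intro x hx
    rw [AddChar.zmodChar_apply, map_pow, Ideal.Quotient.lift_mk] at hx
    have : z ^ x.val = 1 := by rw [← hx]; rfl
    have := hz.dvd_of_pow_eq_one _ this
    have h3 := Nat.eq_zero_of_dvd_of_lt this (ZMod.val_lt x)
    exact (ZMod.val_eq_zero x).mp h3

namespace GD
variable {n : ℕ} {G k : Type} [CommRing G] [Field k] (d : GD n G k)

theorem four (d : GD n G k) : (4 : G) = 0 := by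
  have : d.φ (4 : ZMod 4) = 0 := by rw [show (4 : ZMod 4) = 0 from rfl, map_zero]
  rwa [map_ofNat] at this

theorem two_ne (d : GD n G k) : (2 : G) ≠ 0 := by
  intro h
  have := d.two_mul 1 (by rw [mul_one, h])
  rw [map_one] at this
  exact one_ne_zero this

theorem two_k (d : GD n G k) : (2 : k) = 0 := by
  have := d.two_mul 2 (by rw [← d.four]; norm_num)
  rwa [map_ofNat] at this

theorem sigma_phi (a : ZMod 4) : d.σ (d.φ a) = d.φ a := by
  have : d.σ.comp d.φ = d.φ := Subsingleton.elim _ _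
  exact congrArg (fun f => f a) this

theorem phi_inj : Function.Injective d.φ := by
  rw [injective_iff_map_eq_zero]
  intro a ha
  have h2 := d.two_ne
  have h3 : d.φ (2 * a) = 0 := by rw [map_mul, ha, mul_zero]
  have h1 : (1 : G) ≠ 0 := fun h => h2 (by rw [← one_add_one_eq_two, h, add_zero])
  have e2 : d.φ 2 = 2 := map_ofNat _ _
  revert ha h3
  fin_cases a
  · intros; rfl
  · intro ha _
    exact absurd (show d.φ 1 = 0 from ha) (by rw [map_one]; exact h1)
  · intro ha _
    exact absurd (show d.φ 2 = 0 from ha) (by rw [e2]; exact h2)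
  · intro _ h3
    exact absurd (show d.φ 2 = 0 from h3) (by rw [e2]; exact h2)

theorem sigma_ne {x : G} (hx : x ≠ 0) : d.σ x ≠ 0 := by
  by_cases h : d.π x = 0
  · obtain ⟨y, rfl⟩ := d.lift x h
    intro h0
    rw [map_mul, map_ofNat] at h0
    have := d.two_mul _ h0
    rw [d.frob] at this
    have hy : d.π y = 0 := by simpa using this
    obtain ⟨w, rfl⟩ := d.lift y hy
    apply hx
    rw [← mul_assoc, show (2 : G) * 2 = 4 by norm_num, d.four, zero_mul]
  · intro h0
    have := d.frob x
    rw [h0, map_zero] at this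
    exact h (by simpa using this.symm)

theorem decomp {x : G} (h : d.π x ^ 2 = d.π x) : ∃ (a : ZMod 4) (y : G), x = d.φ a + 2 * y := by
  have h' : d.π x * (d.π x - 1) = 0 := by rw [mul_sub, mul_one, ← sq, h, sub_self]
  rcases mul_eq_zero.mp h' with h0 | h1
  · obtain ⟨y, rfl⟩ := d.lift x h0
    exact ⟨0, y, by simp⟩
  · obtain ⟨y, hy⟩ := d.lift (x - 1) (by rw [map_sub, map_one, h1])
    exact ⟨1, y, by rw [map_one, ← hy]; ring⟩

theorem fixed {x : G} (h : d.σ x = x) : ∃ a, x = d.φ a := by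
  obtain ⟨a, y, rfl⟩ := d.decomp (x := x) (by rw [← d.frob, h])
  rw [map_add, d.sigma_phi, map_mul, map_ofNat] at h
  have h2 : 2 * (d.σ y - y) = 0 := by rw [mul_sub]; exact sub_eq_zero.mpr (add_left_cancel h)
  have h3 := d.two_mul _ h2
  rw [map_sub, d.frob, sub_eq_zero] at h3
  obtain ⟨b, w, rfl⟩ := d.decomp h3
  refine ⟨a + 2 * b, ?_⟩
  rw [map_add, map_mul, map_ofNat]
  linear_combination w * d.four

/-- Character sums vanish. -/
theorem sum_char {A : Type*} [AddGroup A] [Fintype A] (ψ : AddChar A G) (x : A)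
    (hx : d.π (ψ x) ≠ 1) : ∑ a, ψ a = 0 := by
  have h1 : ψ x * ∑ a, ψ a = ∑ a, ψ a := by
    rw [Finset.mul_sum]
    simp_rw [← AddChar.map_add_eq_mul]
    exact Fintype.sum_equiv (Equiv.addLeft x) _ _ (fun a => rfl)
  have h2 : IsUnit (ψ x - 1) := d.unit _ (by rw [map_sub, map_one]; exact sub_ne_zero.mpr hx)
  apply h2.mul_left_cancel
  rw [sub_mul, h1, one_mul, sub_self, mul_zero]

theorem sum_mul [NeZero n] (x : ZMod n) : ∑ j, d.χ (j * x) = if x = 0 then (n : G) else 0 := by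
  split_ifs with h
  · subst h; simp [ZMod.card]
  · have := d.sum_char (d.χ.mulShift x) 1 (by
      rw [AddChar.mulShift_apply, mul_one]; exact fun h' => h (d.prim x h'))
    rw [← this]
    exact Finset.sum_congr rfl fun j _ => by rw [AddChar.mulShift_apply, mul_comm]

/-- Discrete Fourier transform. -/
noncomputable def S [NeZero n] (f : ZMod n → ZMod 4) (j : ZMod n) : G :=
  ∑ u, d.φ (f u) * d.χ (j * u)

theorem S_two [NeZero n] (f : ZMod n → ZMod 4) (j : ZMod n) : d.S f (2 * j) = d.σ (d.S f j) := by
  unfold S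
  rw [map_sum]
  refine Finset.sum_congr rfl fun u _ => ?_
  rw [map_mul d.σ, d.sigma_phi, d.sig, mul_assoc]

theorem S_shift [NeZero n] (f : ZMod n → ZMod 4) (j a : ZMod n) :
    d.S (fun u => f (u + a)) j = d.χ (-(j * a)) * d.S f j := by
  unfold S
  rw [Finset.mul_sum]
  refine Fintype.sum_equiv (Equiv.addRight a) _ _ fun u => ?_
  simp only [Equiv.coe_addRight]
  rw [mul_left_comm, ← AddChar.map_add_eq_mul]
  congr 2; ring

theorem S_inj [NeZero n] (hn : Odd n) (f : ZMod n → ZMod 4) (h : ∀ j, d.S f j = 0) (u : ZMod n) :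
    f u = 0 := by
  have h1 : ∑ j, d.χ (-(j * u)) * d.S f j = (n : G) * d.φ (f u) := by
    unfold S
    simp_rw [Finset.mul_sum]
    rw [Finset.sum_comm]
    have : ∀ v : ZMod n, ∑ j, d.χ (-(j * u)) * (d.φ (f v) * d.χ (j * v))
        = d.φ (f v) * (if v - u = 0 then (n : G) else 0) := by
      intro v
      rw [← d.sum_mul, Finset.mul_sum]
      refine Finset.sum_congr rfl fun j _ => ?_
      rw [mul_left_comm, ← AddChar.map_add_eq_mul]
      congr 2; ring
    simp_rw [this, sub_eq_zero]
    simp [mul_comm]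
  simp only [h, mul_zero, Finset.sum_const_zero] at h1
  have hu : IsUnit (n : G) := d.unit _ (by
    obtain ⟨m, rfl⟩ := hn
    rw [map_natCast]; push_cast
    rw [d.two_k]; simp)
  have h2 : d.φ (f u) = 0 := hu.mul_left_cancel (by rw [← h1, mul_zero])
  exact (map_eq_zero_iff _ d.phi_inj).mp h2

end GD

open Polynomial in
theorem GD.isLeast {n : ℕ} {G k : Type} [CommRing G] [Field k] [DecidableEq G] (d : GD n G k)
    [NeZero n] (hn : Odd n) (f : ZMod n → ZMod 4) (E : ℕ → ZMod 4) (hE : ∀ u : ℕ, E u = f u) :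
    IsLeast {L : ℕ | ∃ c : Fin L → ZMod 4,
          ∀ u : ℕ, E (u + L) + ∑ i : Fin L, c i * E (u + L - 1 - i.val) = 0}
      (Finset.univ.filter (fun j => d.S f j ≠ 0)).card := by
  -- key identity
  have key : ∀ (L : ℕ) (c : Fin L → ZMod 4) (j : ZMod n),
      d.S (fun u => f (u + L) + ∑ i : Fin L, c i * f (u + ((L - 1 - i.val : ℕ) : ZMod n))) j
      = (d.χ (-j) ^ L + ∑ i : Fin L, d.φ (c i) * d.χ (-j) ^ (L - 1 - i.val)) * d.S f j := by
    intro L c j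
    have hs : ∀ m : ℕ, d.S (fun u => f (u + (m : ZMod n))) j = d.χ (-j) ^ m * d.S f j := by
      intro m
      rw [d.S_shift, ← AddChar.map_nsmul_eq_pow]
      congr 2
      rw [nsmul_eq_mul]; ring
    rw [add_mul, ← hs, Finset.sum_mul]
    simp_rw [mul_assoc, ← hs]
    unfold GD.S
    simp_rw [map_add, map_sum, add_mul, Finset.sum_mul, Finset.sum_add_distrib, Finset.mul_sum]
    congr 1
    rw [Finset.sum_comm]
    refine Finset.sum_congr rfl fun i _ => Finset.sum_congr rfl fun u _ => ?_
    rw [map_mul d.φ, mul_assoc]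
  have rel : ∀ (L : ℕ) (c : Fin L → ZMod 4),
      (∀ u : ℕ, E (u + L) + ∑ i : Fin L, c i * E (u + L - 1 - i.val) = 0) ↔
      (∀ u : ZMod n, f (u + L) + ∑ i : Fin L, c i * f (u + ((L - 1 - i.val : ℕ) : ZMod n)) = 0) := by
    intro L c
    have e1 : ∀ u : ℕ, E (u + L) + ∑ i : Fin L, c i * E (u + L - 1 - i.val)
        = f ((u : ZMod n) + L) + ∑ i : Fin L, c i * f ((u : ZMod n) + ((L - 1 - i.val : ℕ) : ZMod n)) := by
      intro u
      rw [hE]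
      push_cast
      congr 1
      refine Finset.sum_congr rfl fun i _ => ?_
      have := i.2
      rw [hE, show u + L - 1 - i.val = u + (L - 1 - i.val) by omega, Nat.cast_add]
    constructor
    · intro h u
      have := h u.val
      rw [e1] at this
      simpa using this
    · intro h u
      rw [e1]; exact h _
  set Z := Finset.univ.filter (fun j => d.S f j ≠ 0) with hZ
  constructor
  · -- upper bound
    let P : G[X] := ∏ j ∈ Z, (X - C (d.χ (-j)))
    have hPm : P.Monic := monic_prod_of_monic _ _ fun j _ => monic_X_sub_C _
    have hG : Nontrivial G := ⟨⟨2, 0, d.two_ne⟩⟩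
    have hPd : P.natDegree = Z.card := by
      rw [natDegree_prod_of_monic _ _ fun j _ => monic_X_sub_C _]
      simp
    have h2u : IsUnit (2 : ZMod n) := by
      have := (ZMod.isUnit_iff_coprime 2 n).mpr (Nat.coprime_two_left.mpr hn)
      exact_mod_cast this
    have hZ2 : ∀ j, 2 * j ∈ Z ↔ j ∈ Z := by
      intro j
      simp only [hZ, Finset.mem_filter, Finset.mem_univ, true_and]
      rw [d.S_two]
      exact ⟨fun h h0 => h (by rw [h0, map_zero]), d.sigma_ne⟩
    have hPs : P.map d.σ = P := by
      rw [Polynomial.map_prod]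
      refine Finset.prod_bij (fun j _ => 2 * j) (fun j hj => (hZ2 j).mpr hj)
        (fun a _ b _ h => h2u.mul_left_cancel h) (fun b hb => ?_) (fun j _ => ?_)
      · obtain ⟨v, hv⟩ := h2u
        have : 2 * (v⁻¹.val * b) = b := by rw [← hv, Units.mul_inv_cancel_left]
        exact ⟨v⁻¹.val * b, (hZ2 _).mp (by rw [this]; exact hb), this⟩
      · rw [Polynomial.map_sub, map_X, map_C, d.sig, mul_neg]
    have hco : ∀ m, ∃ a, P.coeff m = d.φ a := by
      intro m
      apply d.fixed
      conv_rhs => rw [← hPs]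
      rw [coeff_map]
    choose a ha using hco
    refine ⟨fun i => a (Z.card - 1 - i.val), ?_⟩
    rw [rel]
    apply d.S_inj hn
    intro j
    rw [key]
    by_cases hj : d.S f j = 0
    · rw [hj, mul_zero]
    · have hjZ : j ∈ Z := by simp [hZ, hj]
      have he : P.eval (d.χ (-j)) = 0 := by
        rw [eval_prod]
        exact Finset.prod_eq_zero hjZ (by simp)
      rw [eval_eq_sum_range, hPd, Finset.sum_range_succ] at he
      have hl : P.coeff Z.card = 1 := by rw [← hPd]; exact hPm
      rw [hl, one_mul, add_comm, ← Finset.sum_range_reflect, Finset.sum_range] at he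
      simp_rw [← ha]
      rw [he, zero_mul]
  · classical
    rintro L ⟨c, hc⟩
    rw [rel] at hc
    have h0 : ∀ j, (d.χ (-j) ^ L + ∑ i : Fin L, d.φ (c i) * d.χ (-j) ^ (L - 1 - i.val)) * d.S f j = 0 := by
      intro j
      rw [← key]
      unfold GD.S
      simp [hc]
    let Q : k[X] := ∑ i : Fin L, C (d.π (d.φ (c i))) * X ^ (L - 1 - i.val)
    have hQ : Q.degree < L := by
      refine (degree_sum_le _ _).trans_lt ?_
      refine (Finset.sup_lt_iff (WithBot.bot_lt_coe L)).mpr ?_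
      intro i _
      refine (degree_C_mul_X_pow_le _ _).trans_lt ?_
      have := i.2
      exact WithBot.coe_lt_coe.mpr (show L - 1 - i.val < L by omega)
    have hm : (X ^ L + Q).Monic := monic_X_pow_add hQ
    have hd : (X ^ L + Q).natDegree = L := by
      rw [natDegree_eq_of_degree_eq_some]
      rw [degree_add_eq_left_of_degree_lt (by rwa [degree_X_pow]), degree_X_pow]
    have hinj : Set.InjOn (fun j => d.π (d.χ (-j))) (Z : Set (ZMod n)) := by
      intro x _ y _ hxy
      have hxy' : d.π (d.χ (-x)) = d.π (d.χ (-y)) := hxy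
      have : d.π (d.χ (-x + y)) = 1 := by
        rw [AddChar.map_add_eq_mul, map_mul d.π, hxy', ← map_mul d.π, ← AddChar.map_add_eq_mul]
        simp
      have := d.prim _ this
      rw [neg_add_eq_zero] at this
      exact this
    rw [← Finset.card_image_of_injOn hinj, ← hd]
    have : Finset.image (fun j => d.π (d.χ (-j))) Z ⊆ (X ^ L + Q).roots.toFinset := by
      intro x hx
      obtain ⟨j, hj, rfl⟩ := Finset.mem_image.mp hx
      rw [Multiset.mem_toFinset, mem_roots hm.ne_zero, IsRoot.def]
      by_contra hne
      have hju : d.S f j ≠ 0 := by simpa [hZ] using hj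
      apply hju
      have hu := d.unit (d.χ (-j) ^ L + ∑ i : Fin L, d.φ (c i) * d.χ (-j) ^ (L - 1 - i.val)) (by
        convert hne
        simp [Q, eval_finsetSum])
      exact hu.mul_left_cancel (by rw [h0, mul_zero])
    exact (Finset.card_le_card this).trans ((Multiset.toFinset_card_le _).trans (card_roots' _))

/-- The discrete logarithm modulo 4. -/
theorem exists_log (q : ℕ) (hq : q.Prime) (hq4 : q % 4 = 1) (g : ℕ)
    (hg : orderOf (g : ZMod q) = q - 1) :
    ∃ F : ZMod q → ZMod 4, F 0 = 0 ∧ (∀ m : ℕ, F ((g : ZMod q) ^ m) = m) ∧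
      (∀ m : ℕ, (g : ZMod q) ^ m ≠ 0) ∧
      (∀ b : ZMod q, b ≠ 0 → ∃ m < q - 1, (g : ZMod q) ^ m = b) := by
  have : Fact q.Prime := ⟨hq⟩
  have hq2 := hq.two_le
  have hg0 : (g : ZMod q) ≠ 0 := by
    intro h
    have h1 := pow_orderOf_eq_one (g : ZMod q)
    rw [hg, h, zero_pow (by omega)] at h1
    exact zero_ne_one h1
  have himg : (Finset.range (q - 1)).image (fun m => (g : ZMod q) ^ m) = Finset.univ.erase 0 := by
    apply Finset.eq_of_subset_of_card_le
    · intro x hx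
      obtain ⟨m, _, rfl⟩ := Finset.mem_image.mp hx
      simp [hg0]
    · rw [Finset.card_image_of_injOn, Finset.card_erase_of_mem (Finset.mem_univ _),
        Finset.card_univ, ZMod.card, Finset.card_range]
      intro a ha b hb hab
      rw [← hg] at ha hb
      exact pow_injOn_Iio_orderOf (by simpa using ha) (by simpa using hb) hab
  have hex : ∀ b : ZMod q, b ≠ 0 → ∃ m < q - 1, (g : ZMod q) ^ m = b := by
    intro b hb
    have : b ∈ Finset.univ.erase (0 : ZMod q) := by simp [hb]
    rw [← himg] at this
    obtain ⟨m, hm, h⟩ := Finset.mem_image.mp this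
    exact ⟨m, by simpa using hm, h⟩
  choose! l hl1 hl2 using hex
  refine ⟨fun b => if b = 0 then 0 else (l b : ZMod 4), by simp, ?_, fun m => pow_ne_zero _ hg0,
    fun b hb => ⟨l b, hl1 b hb, hl2 b hb⟩⟩
  intro m
  have hm := pow_ne_zero m hg0
  simp only [hm, if_false]
  have h := hl2 _ hm
  have hof : IsOfFinOrder (g : ZMod q) := by rw [← orderOf_pos_iff, hg]; omega
  rw [hof.pow_eq_pow_iff_modEq, hg] at h
  rw [ZMod.natCast_eq_natCast_iff]
  exact h.of_dvd (by omega)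

theorem log_mul {q : ℕ} {g : ℕ} {F : ZMod q → ZMod 4} (h1 : ∀ m : ℕ, F ((g : ZMod q) ^ m) = m)
    (h2 : ∀ b : ZMod q, b ≠ 0 → ∃ m < q - 1, (g : ZMod q) ^ m = b) {x y : ZMod q}
    (hx : x ≠ 0) (hy : y ≠ 0) : F (x * y) = F x + F y := by
  obtain ⟨a, _, rfl⟩ := h2 x hx
  obtain ⟨b, _, rfl⟩ := h2 y hy
  rw [← pow_add, h1, h1, h1, Nat.cast_add]

theorem log_sum {q : ℕ} [Fact q.Prime] (hq8 : q % 8 = 1) {g : ℕ} (hg : orderOf (g : ZMod q) = q - 1)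
    {F : ZMod q → ZMod 4} (h0 : F 0 = 0) (h1 : ∀ m : ℕ, F ((g : ZMod q) ^ m) = m)
    (hn : ∀ m : ℕ, (g : ZMod q) ^ m ≠ 0)
    (h2 : ∀ b : ZMod q, b ≠ 0 → ∃ m < q - 1, (g : ZMod q) ^ m = b) : ∑ b, F b = 0 := by
  have hs : ∑ b, F b = ∑ m ∈ Finset.range (q - 1), (m : ZMod 4) := by
    rw [← Finset.add_sum_erase _ _ (Finset.mem_univ 0), h0, zero_add]
    symm
    refine Finset.sum_bij (fun m _ => (g : ZMod q) ^ m) (fun m _ => by simp [hn]) ?_ ?_ ?_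
    · intro a ha b hb hab
      rw [← hg] at ha hb
      exact pow_injOn_Iio_orderOf (by simpa using ha) (by simpa using hb) hab
    · intro b hb
      obtain ⟨m, hm, h⟩ := h2 b (by simpa using hb)
      exact ⟨m, by simpa using hm, h⟩
    · intro m _; rw [h1]
  rw [hs, ← Nat.cast_sum, ZMod.natCast_eq_zero_iff]
  have h3 := Finset.sum_range_id_mul_two (q - 1)
  obtain ⟨t, ht⟩ : ∃ t, q - 1 = 8 * t := ⟨q / 8, by omega⟩
  rw [ht] at h3 ⊢
  refine ⟨t * (8 * t - 1), ?_⟩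
  nlinarith

theorem log_fiber {q : ℕ} [Fact q.Prime] {g : ℕ}
    {F : ZMod q → ZMod 4} (h1 : ∀ m : ℕ, F ((g : ZMod q) ^ m) = m)
    (hn : ∀ m : ℕ, (g : ZMod q) ^ m ≠ 0)
    (h2 : ∀ b : ZMod q, b ≠ 0 → ∃ m < q - 1, (g : ZMod q) ^ m = b) (c : ZMod 4) :
    4 * (Finset.univ.filter (fun b : ZMod q => b ≠ 0 ∧ F b = c)).card = q - 1 := by
  let N : ZMod 4 → ℕ := fun c => (Finset.univ.filter (fun b : ZMod q => b ≠ 0 ∧ F b = c)).card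
  have hg0 : (g : ZMod q) ≠ 0 := by simpa using hn 1
  have hg1 : F g = 1 := by simpa using h1 1
  have hN : ∀ c, N (c + 1) = N c := by
    intro c
    symm
    refine Finset.card_bij (fun b _ => (g : ZMod q) * b) ?_ ?_ ?_
    · intro b hb
      simp only [Finset.mem_filter, Finset.mem_univ, true_and] at hb ⊢
      refine ⟨mul_ne_zero hg0 hb.1, ?_⟩
      rw [log_mul h1 h2 hg0 hb.1, hg1, hb.2, add_comm]
    · intro a _ b _ hab
      exact mul_left_cancel₀ hg0 hab
    · intro b hb
      simp only [Finset.mem_filter, Finset.mem_univ, true_and] at hb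
      have hb' : (g : ZMod q)⁻¹ * b ≠ 0 := mul_ne_zero (inv_ne_zero hg0) hb.1
      have he : (g : ZMod q) * ((g : ZMod q)⁻¹ * b) = b := mul_inv_cancel_left₀ hg0 b
      refine ⟨(g : ZMod q)⁻¹ * b, ?_, he⟩
      simp only [Finset.mem_filter, Finset.mem_univ, true_and]
      refine ⟨hb', ?_⟩
      have := log_mul h1 h2 hg0 hb'
      rw [he, hb.2, hg1, add_comm] at this
      exact (add_left_cancel this).symm
  have hN0 : ∀ c, N c = N 0 := by
    have a1 := hN 0
    have a2 := hN 1
    have a3 := hN 2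
    intro c
    fin_cases c
    · rfl
    · exact a1
    · exact a2.trans a1
    · exact a3.trans (a2.trans a1)
  have hsum : (Finset.univ.filter (fun b : ZMod q => b ≠ 0)).card = ∑ c : ZMod 4, N c := by
    rw [Finset.card_eq_sum_card_fiberwise (f := F) (t := Finset.univ) (fun _ _ => by simp)]
    refine Finset.sum_congr rfl fun c _ => ?_
    rw [Finset.filter_filter]
  rw [Finset.sum_congr rfl (fun c _ => hN0 c)] at hsum
  have h3 : (Finset.univ.filter (fun b : ZMod q => b ≠ 0)).card = q - 1 := by
    rw [Finset.filter_ne', Finset.card_erase_of_mem (Finset.mem_univ _), Finset.card_univ, ZMod.card]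
  have h4 : N c = N 0 := hN0 c
  simp only [Finset.sum_const, Finset.card_univ, ZMod.card, smul_eq_mul] at hsum
  change 4 * N c = q - 1
  omega

/-- The character sum `T`. -/
theorem T_shift {n q : ℕ} {G k : Type} [CommRing G] [Field k] (d : GD n G k) [Fact q.Prime] {g : ℕ}
    {F : ZMod q → ZMod 4} (h0 : F 0 = 0) (h1 : ∀ m : ℕ, F ((g : ZMod q) ^ m) = m)
    (h2 : ∀ b : ZMod q, b ≠ 0 → ∃ m < q - 1, (g : ZMod q) ^ m = b)
    (ψ : AddChar (ZMod q) G) (hψ : ∀ x, d.π (ψ x) = 1 → x = 0) (c : ZMod q) (hc : c ≠ 0) :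
    ∑ b, d.φ (F b) * ψ (c * b) = (∑ b, d.φ (F b) * ψ b) + d.φ (F c) := by
  have hs : ∑ b, ψ b = 0 := d.sum_char ψ 1 (fun h => one_ne_zero (hψ 1 h))
  have e1 : ∑ b, d.φ (F b) * ψ b = ∑ b, d.φ (F (c * b)) * ψ (c * b) :=
    (Fintype.sum_equiv (Equiv.mulLeft₀ c hc) _ _ (fun b => rfl)).symm
  have e2 : ∑ b, ψ (c * b) = 0 := by
    rw [← hs]; exact Fintype.sum_equiv (Equiv.mulLeft₀ c hc) _ _ (fun b => rfl)
  have e3 : ∑ b, d.φ (F (c * b)) * ψ (c * b)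
      = ∑ b, (d.φ (F b) * ψ (c * b) + d.φ (F c) * ψ (c * b)
        - if b = 0 then d.φ (F c) else 0) := by
    refine Finset.sum_congr rfl fun b _ => ?_
    by_cases hb : b = 0
    · subst hb; simp [h0]
    · rw [log_mul h1 h2 hc hb, map_add]; simp [hb]; ring
  rw [Finset.sum_sub_distrib, Finset.sum_add_distrib, ← Finset.mul_sum, e2] at e3
  rw [e1, e3]; simp

theorem count_S {p q : ℕ} (hp : p.Prime) (hq : q.Prime) [NeZero (p * q)] (hco : p.Coprime q)
    (hp8 : p % 8 = 5) (hq8 : q % 8 = 1)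
    {G k : Type} [CommRing G] [Field k] [DecidableEq G] (d : GD (p * q) G k) {g : ℕ}
    (hg : orderOf (g : ZMod q) = q - 1)
    {F : ZMod q → ZMod 4} (h0 : F 0 = 0) (h1 : ∀ m : ℕ, F ((g : ZMod q) ^ m) = m)
    (hn : ∀ m : ℕ, (g : ZMod q) ^ m ≠ 0)
    (h2 : ∀ b : ZMod q, b ≠ 0 → ∃ m < q - 1, (g : ZMod q) ^ m = b)
    (f : ZMod (p * q) → ZMod 4)
    (hf : ∀ a b, f ((ZMod.chineseRemainder hco).symm (a, b)) =
      (if b = 0 then 2 else 0) + F b - if a = 0 then F b else 0) :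
    (F 2 = 0 → (Finset.univ.filter (fun j => d.S f j ≠ 0)).card = q + 3 * (p - 1) * (q - 1) / 4) ∧
    (F 2 = 2 → (Finset.univ.filter (fun j => d.S f j ≠ 0)).card = p * q - p + 1) := by
  have : Fact p.Prime := ⟨hp⟩
  have : Fact q.Prime := ⟨hq⟩
  set r := (ZMod.chineseRemainder hco).symm with hr
  let ψ1 : AddChar (ZMod p) G :=
    { toFun := fun a => d.χ (r (a, 0))
      map_zero_eq_one' := by
        rw [show ((0 : ZMod p), (0 : ZMod q)) = 0 from rfl, map_zero, AddChar.map_zero_eq_one]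
      map_add_eq_mul' := fun a b => by
        rw [← AddChar.map_add_eq_mul, ← map_add]; simp }
  let ψ2 : AddChar (ZMod q) G :=
    { toFun := fun a => d.χ (r (0, a))
      map_zero_eq_one' := by
        rw [show ((0 : ZMod p), (0 : ZMod q)) = 0 from rfl, map_zero, AddChar.map_zero_eq_one]
      map_add_eq_mul' := fun a b => by
        rw [← AddChar.map_add_eq_mul, ← map_add]; simp }
  have hψ1 : ∀ x, d.π (ψ1 x) = 1 → x = 0 := by
    intro x hx
    have := (map_eq_zero_iff r r.injective).mp (d.prim _ hx)
    exact congrArg Prod.fst this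
  have hψ2 : ∀ x, d.π (ψ2 x) = 1 → x = 0 := by
    intro x hx
    have := (map_eq_zero_iff r r.injective).mp (d.prim _ hx)
    exact congrArg Prod.snd this
  have hσ : ∀ x, d.σ (ψ2 x) = ψ2 (2 * x) := by
    intro x
    change d.σ (d.χ (r (0, x))) = d.χ (r (0, 2 * x))
    rw [d.sig]
    congr 1
    rw [two_mul, two_mul, ← map_add]; simp
  have hχ : ∀ a b, d.χ (r (a, b)) = ψ1 a * ψ2 b := by
    intro a b
    change _ = d.χ (r (a, 0)) * d.χ (r (0, b))
    rw [← AddChar.map_add_eq_mul, ← map_add]; simp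
  let T : ZMod q → G := fun c => ∑ b, d.φ (F b) * ψ2 (c * b)
  let A : ZMod p → G := fun c => ∑ a, ψ1 (c * a)
  have hS : ∀ a b, d.S f (r (a, b)) = 2 * A a + A a * T b - T b := by
    intro a b
    have e2 : d.φ 2 = 2 := map_ofNat _ _
    unfold GD.S
    rw [← r.toEquiv.sum_comp, Fintype.sum_prod_type]
    have : ∀ x y, d.φ (f (r.toEquiv (x, y))) * d.χ (r (a, b) * r.toEquiv (x, y))
        = ψ1 (a * x) * (if y = 0 then 2 else 0) + ψ1 (a * x) * (d.φ (F y) * ψ2 (b * y))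
          - (if x = 0 then d.φ (F y) * ψ2 (b * y) else 0) := by
      intro x y
      rw [RingEquiv.toEquiv_eq_coe, RingEquiv.coe_toEquiv, hf, ← map_mul r, Prod.mk_mul_mk, hχ]
      by_cases hx : x = 0 <;> by_cases hy : y = 0
      · subst hx hy; simp [h0, e2]
      · subst hx; simp [hy]
      · subst hy; simp [hx, h0, e2]; ring
      · simp [hx, hy]; ring
    simp_rw [this, Finset.sum_sub_distrib, Finset.sum_add_distrib, ← Finset.mul_sum,
      ← Finset.sum_mul]
    have e : ∑ x : ZMod p, ∑ y : ZMod q, (if x = 0 then d.φ (F y) * ψ2 (b * y) else 0) = T b := by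
      rw [Finset.sum_comm]; simp [T]
    rw [e]
    simp only [Finset.sum_ite_eq', Finset.mem_univ, if_true]
    change A a * 2 + A a * T b - T b = _
    ring
  have hA0 : A 0 = 1 := by
    simp only [A, zero_mul, AddChar.map_zero_eq_one, Finset.sum_const, Finset.card_univ, ZMod.card,
      nsmul_eq_mul, mul_one]
    obtain ⟨t, ht⟩ : ∃ t, p = 4 * t + 1 := ⟨p / 4, by omega⟩
    rw [ht]; push_cast
    rw [d.four]; ring
  have hA1 : ∀ a, a ≠ 0 → A a = 0 := by
    intro a ha
    have := d.sum_char ψ1 1 (fun h => one_ne_zero (hψ1 1 h))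
    rw [← this]
    exact Fintype.sum_equiv (Equiv.mulLeft₀ a ha) _ _ (fun b => rfl)
  have hT0 : T 0 = 0 := by
    simp only [T, zero_mul, AddChar.map_zero_eq_one, mul_one]
    rw [← map_sum, log_sum hq8 hg h0 h1 hn h2, map_zero]
  have hT1 : ∀ c, c ≠ 0 → T c = T 1 + d.φ (F c) := by
    intro c hc
    have := T_shift d h0 h1 h2 ψ2 hψ2 c hc
    simpa [T] using this
  have hne2 : (2 : ZMod q) ≠ 0 := by
    intro h
    have : ((2 : ℕ) : ZMod q) = 0 := by exact_mod_cast h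
    rw [ZMod.natCast_eq_zero_iff] at this
    have := (Nat.prime_dvd_prime_iff_eq hq Nat.prime_two).mp this
    omega
  have hTσ : d.σ (T 1) = T 1 + d.φ (F 2) := by
    rw [← hT1 2 hne2]
    simp only [T]
    rw [map_sum]
    refine Finset.sum_congr rfl fun b _ => ?_
    rw [map_mul d.σ, d.sigma_phi, hσ, one_mul]
  have hcard : (Finset.univ.filter (fun j => d.S f j ≠ 0)).card
      = q + (p - 1) * (Finset.univ.filter (fun b : ZMod q => b ≠ 0 ∧ T 1 + d.φ (F b) ≠ 0)).card := by
    have e1 : Finset.univ.filter (fun j => d.S f j ≠ 0)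
      = (({0} ×ˢ Finset.univ) ∪ (Finset.univ.erase (0 : ZMod p)) ×ˢ
        (Finset.univ.filter (fun b : ZMod q => b ≠ 0 ∧ T 1 + d.φ (F b) ≠ 0))).map
        r.toEquiv.toEmbedding := by
      ext j
      obtain ⟨⟨a, b⟩, rfl⟩ := r.surjective j
      rw [Finset.mem_filter]
      simp only [Finset.mem_univ, true_and, Finset.mem_map_equiv, RingEquiv.toEquiv_eq_coe]
      rw [hS]
      have : ((r : ZMod p × ZMod q ≃ ZMod (p * q)).symm (r (a, b))) = (a, b) := r.symm_apply_apply _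
      rw [this]
      by_cases ha : a = 0
      · subst ha
        rw [hA0]
        simpa using d.two_ne
      · rw [hA1 a ha]
        by_cases hb : b = 0
        · subst hb
          simp [hT0, Ne.symm ha]
        · rw [hT1 b hb]
          rw [mul_zero, zero_mul, zero_add, zero_sub, neg_ne_zero]
          simp [ha, Ne.symm ha, hb]
    rw [e1, Finset.card_map, Finset.card_union_of_disjoint, Finset.card_product,
      Finset.card_product, Finset.card_erase_of_mem (Finset.mem_univ _)]
    · simp [ZMod.card]
    · rw [Finset.disjoint_left]
      rintro ⟨a, b⟩ h h'
      simp at h h'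
      exact h'.1 h.symm
  have hq1 : (Finset.univ.filter (fun b : ZMod q => b ≠ 0)).card = q - 1 := by
    rw [Finset.filter_ne', Finset.card_erase_of_mem (Finset.mem_univ _), Finset.card_univ, ZMod.card]
  rw [hcard]
  constructor
  · intro hF
    rw [hF, map_zero, add_zero] at hTσ
    obtain ⟨t, ht⟩ := d.fixed hTσ
    have hfib := log_fiber h1 hn h2 (-t)
    have hsplit := Finset.card_filter_add_card_filter_not (s := Finset.univ.filter (fun b : ZMod q => b ≠ 0))
      (fun b => F b = -t)
    rw [Finset.filter_filter, Finset.filter_filter, hq1] at hsplit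
    have e2 : Finset.univ.filter (fun b : ZMod q => b ≠ 0 ∧ T 1 + d.φ (F b) ≠ 0)
        = Finset.univ.filter (fun b : ZMod q => b ≠ 0 ∧ ¬ F b = -t) := by
      refine Finset.filter_congr fun b _ => ?_
      rw [ht, ← map_add, Ne, Ne, map_eq_zero_iff _ d.phi_inj, add_comm t, add_eq_zero_iff_eq_neg]
    rw [e2]
    generalize (Finset.univ.filter (fun b : ZMod q => b ≠ 0 ∧ ¬ F b = -t)).card = y at *
    generalize (Finset.univ.filter (fun b : ZMod q => b ≠ 0 ∧ F b = -t)).card = x at *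
    have hx : q - 1 = 4 * x := hfib.symm
    have hy : y = 3 * x := by omega
    rw [hx, hy]
    congr 1
    rw [show 3 * (p - 1) * (4 * x) = ((p - 1) * (3 * x)) * 4 by ring, Nat.mul_div_cancel _ (by norm_num)]
  · intro hF
    have e2 : Finset.univ.filter (fun b : ZMod q => b ≠ 0 ∧ T 1 + d.φ (F b) ≠ 0)
        = Finset.univ.filter (fun b : ZMod q => b ≠ 0) := by
      refine Finset.filter_congr fun b _ => ?_
      refine ⟨fun h => h.1, fun h => ⟨h, fun h' => ?_⟩⟩
      have h3 : T 1 = d.φ (-F b) := by rw [map_neg]; exact eq_neg_of_add_eq_zero_left h'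
      rw [hF, h3, d.sigma_phi] at hTσ
      have h4 : d.φ 2 = 0 := by simpa using hTσ
      rw [map_ofNat] at h4
      exact d.two_ne h4
    rw [e2, hq1]
    obtain ⟨a, rfl⟩ : ∃ a, p = a + 1 := ⟨p - 1, by omega⟩
    obtain ⟨b, rfl⟩ : ∃ b, q = b + 1 := ⟨q - 1, by omega⟩
    have : (a + 1) * (b + 1) = (a * b + b) + (a + 1) := by ring
    rw [this]; simp only [Nat.add_sub_cancel]; ring

theorem stmt18
    (p q : ℕ) (hp : Nat.Prime p) (hq : Nat.Prime q) (hne : p ≠ q)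
    (hpo : Odd p) (hqo : Odd q)
    (hgcd : Nat.gcd (p - 1) (q - 1) = 4)
    (e : ℕ) (he : e = (p - 1) * (q - 1) / 4)
    (g h : ℕ)
    (hgp : orderOf (g : ZMod p) = p - 1)
    (hgq : orderOf (g : ZMod q) = q - 1)
    (hhp : (h : ZMod p) = (g : ZMod p))
    (hhq : (h : ZMod q) = 1)
    (D : ℕ → Finset (ZMod (p * q)))
    (hD : ∀ i, D i = (Finset.range (e / 4) ×ˢ Finset.range 4).image
        (fun sj => (g : ZMod (p * q)) ^ (4 * sj.1 + i) * (h : ZMod (p * q)) ^ sj.2))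
    (Pset Qset : Finset (ZMod (p * q)))
    (hP : Pset = (Finset.Icc 1 (q - 1)).image (fun k => ((k * p : ℕ) : ZMod (p * q))))
    (hQ : Qset = (Finset.Icc 1 (p - 1)).image (fun k => ((k * q : ℕ) : ZMod (p * q))))
    (E : ℕ → ZMod 4)
    (hE2 : ∀ u : ℕ, ((u : ZMod (p * q)) ∈ Qset ∨ (u : ZMod (p * q)) = 0) → E u = 2)
    (hE0 : ∀ u : ℕ, (u : ZMod (p * q)) ∈ Pset → E u = 0)
    (hED : ∀ u : ℕ, ∀ i < 4, (u : ZMod (p * q)) ∈ D i → E u = (i : ZMod 4))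
    (hq8 : q % 8 = 1) (hp8 : p % 8 = 5) :
    ((2 : ZMod (p * q)) ∈ D 0 →
      IsLeast {L : ℕ | ∃ c : Fin L → ZMod 4,
          ∀ u : ℕ, E (u + L) + ∑ i : Fin L, c i * E (u + L - 1 - i.val) = 0}
        (q + 3 * (p - 1) * (q - 1) / 4)) ∧
    ((2 : ZMod (p * q)) ∈ D 2 →
      IsLeast {L : ℕ | ∃ c : Fin L → ZMod 4,
          ∀ u : ℕ, E (u + L) + ∑ i : Fin L, c i * E (u + L - 1 - i.val) = 0}
        (p * q - p + 1)) := by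
  have : Fact p.Prime := ⟨hp⟩
  have : Fact q.Prime := ⟨hq⟩
  have : NeZero (p * q) := ⟨mul_ne_zero hp.ne_zero hq.ne_zero⟩
  have hco : p.Coprime q := (Nat.coprime_primes hp hq).mpr hne
  obtain ⟨F, h0, h1, hn, h2⟩ := exists_log q hq (by omega) g hgq
  obtain ⟨_, _, _, _, h2p⟩ := exists_log p hp (by omega) g hgp
  obtain ⟨G, k, _, _, ⟨d⟩⟩ := exists_GD (p * q) (hpo.mul hqo)
  classical
  set cr := ZMod.chineseRemainder hco with hcr
  have hcrn : ∀ u : ℕ, cr (u : ZMod (p * q)) = ((u : ZMod p), (u : ZMod q)) := by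
    intro u
    rw [map_natCast]; rfl
  let f : ZMod (p * q) → ZMod 4 := fun x =>
    (if (cr x).2 = 0 then 2 else 0) + F (cr x).2 - if (cr x).1 = 0 then F (cr x).2 else 0
  have hf : ∀ a b, f (cr.symm (a, b)) =
      (if b = 0 then 2 else 0) + F b - if a = 0 then F b else 0 := by
    intro a b
    simp only [f, RingEquiv.apply_symm_apply]
  have hE : ∀ u : ℕ, E u = f u := by
    intro u
    simp only [f, hcrn]
    by_cases hq0 : (u : ZMod q) = 0
    · rw [hq0, h0]
      simp only [if_true, add_zero, ite_self, sub_zero]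
      apply hE2
      obtain ⟨v, rfl⟩ := (ZMod.natCast_eq_zero_iff _ _).mp hq0
      have hv : ((q * v : ℕ) : ZMod (p * q)) = ((v % p * q : ℕ) : ZMod (p * q)) := by
        rw [ZMod.natCast_eq_natCast_iff, mul_comm q v]
        exact ((Nat.mod_modEq v p).symm.mul_right' q)
      have hlt := Nat.mod_lt v hp.pos
      rw [hv]
      rcases Nat.eq_zero_or_pos (v % p) with h | h
      · right; rw [h]; simp
      · left
        rw [hQ]
        exact Finset.mem_image.mpr ⟨v % p, Finset.mem_Icc.mpr ⟨h, by omega⟩, rfl⟩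
    · by_cases hp0 : (u : ZMod p) = 0
      · rw [hp0]
        simp only [hq0, if_true, if_false, zero_add, sub_self]
        apply hE0
        obtain ⟨v, rfl⟩ := (ZMod.natCast_eq_zero_iff _ _).mp hp0
        have hv : ((p * v : ℕ) : ZMod (p * q)) = ((v % q * p : ℕ) : ZMod (p * q)) := by
          rw [ZMod.natCast_eq_natCast_iff, mul_comm p v, mul_comm p q]
          exact ((Nat.mod_modEq v q).symm.mul_right' p)
        have hlt := Nat.mod_lt v hq.pos
        have h : v % q ≠ 0 := by
          intro h
          apply hq0
          rw [ZMod.natCast_eq_zero_iff]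
          exact (Nat.dvd_of_mod_eq_zero h).mul_left p
        rw [hv, hP]
        exact Finset.mem_image.mpr ⟨v % q, Finset.mem_Icc.mpr ⟨by omega, by omega⟩, rfl⟩
      · simp only [hq0, hp0, if_false, zero_add, sub_zero]
        obtain ⟨m, hm, hgm⟩ := h2 _ hq0
        obtain ⟨l, hl, hgl⟩ := h2p _ hp0
        -- choose j
        let j := (l + 3 * m) % 4
        have hj : j < 4 := Nat.mod_lt _ (by norm_num)
        have hp5 : 5 ≤ p := by omega
        have hq9 : 9 ≤ q := by have := hq.two_le; omega
        have hmod : l + (p - 1) * 4 - j ≡ m [MOD Nat.gcd (p - 1) (q - 1)] := by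
          rw [hgcd]
          unfold Nat.ModEq
          omega
        have hlt := Nat.chineseRemainder'_lt_lcm hmod (by omega) (by omega)
        obtain ⟨ht1, ht2⟩ := (Nat.chineseRemainder' hmod).2
        generalize (Nat.chineseRemainder' hmod).1 = t at hlt ht1 ht2
        have hlcm : Nat.lcm (p - 1) (q - 1) = e := by rw [Nat.lcm, hgcd, he]
        have h4e : 4 ∣ e := by
          rw [← hlcm]; exact (show 4 ∣ p - 1 by omega).trans (Nat.dvd_lcm_left _ _)
        rw [hlcm] at hlt
        have hmem : (u : ZMod (p * q)) ∈ D (t % 4) := by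
          rw [hD]
          refine Finset.mem_image.mpr ⟨(t / 4, j), ?_, ?_⟩
          · simp only [Finset.mem_product, Finset.mem_range]
            exact ⟨by omega, hj⟩
          · simp only []
            rw [show 4 * (t / 4) + t % 4 = t by omega]
            apply cr.injective
            rw [hcrn, map_mul, map_pow, map_pow, hcrn, hcrn, hhp, hhq]
            simp only [Prod.pow_mk, Prod.mk_mul_mk, one_pow, mul_one, ← pow_add]
            have ofp : IsOfFinOrder (g : ZMod p) := by rw [← orderOf_pos_iff, hgp]; omega
            have ofq : IsOfFinOrder (g : ZMod q) := by rw [← orderOf_pos_iff, hgq]; omega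
            rw [← hgm, ← hgl]
            congr 1
            · rw [ofp.pow_eq_pow_iff_modEq, hgp]
              have h5 := ht1.add_right j
              rw [show l + (p - 1) * 4 - j + j = l + (p - 1) * 4 by omega] at h5
              exact h5.trans (by simp [Nat.ModEq])
            · rw [ofq.pow_eq_pow_iff_modEq, hgq]
              exact ht2
        rw [hED u (t % 4) (Nat.mod_lt _ (by norm_num)) hmem, ← hgm, h1, ZMod.natCast_eq_natCast_iff]
        exact (Nat.mod_modEq t 4).trans (ht2.of_dvd (by omega))
  have hF2 : ∀ i : ℕ, (2 : ZMod (p * q)) ∈ D i → F 2 = i := by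
    intro i hi
    rw [hD] at hi
    obtain ⟨⟨s, j⟩, _, hs⟩ := Finset.mem_image.mp hi
    have hs' := congrArg (fun x => (cr x).2) hs
    simp only [map_mul, map_pow, hcrn, map_ofNat] at hs'
    simp only [Prod.pow_mk, Prod.mk_mul_mk, hhq, one_pow, mul_one] at hs'
    have h22 : F 2 = F ((g : ZMod q) ^ (4 * s + i)) := congrArg F hs'.symm
    rw [h22, h1]
    push_cast
    rw [show (4 : ZMod 4) = 0 from rfl]; ring
  have hmain := d.isLeast (hpo.mul hqo) f E hE
  obtain ⟨c1, c2⟩ := count_S hp hq hco hp8 hq8 d hgq h0 h1 hn h2 f hf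
  constructor
  · intro h
    rw [← c1 (by simpa using hF2 0 h)]
    exact hmain
  · intro h
    rw [← c2 (by simpa using hF2 2 h)]
    exact hmain
end

section
/- Suppose q ≡ 5 (mod 8) and p ≡ 1 (mod 4). Then the linear complexity of the quaternary sequence (e_u) is L((e_u)) = pq. -/
open Finset in
lemma aux_sum_zmod {M : Type*} [AddCommMonoid M] (n m r : ℕ) [NeZero n] (hm : Nat.Coprime m n)
    (G : ZMod n → M) :
    ∑ t ∈ range n, G ((r + t * m : ℕ) : ZMod n) = ∑ y : ZMod n, G y := by
  have hu : IsUnit (m : ZMod n) := (ZMod.isUnit_iff_coprime m n).2 hm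
  refine Finset.sum_bij (fun t _ => ((r + t * m : ℕ) : ZMod n)) (fun _ _ => Finset.mem_univ _)
    ?_ ?_ (fun _ _ => rfl)
  · intro a ha b hb hab
    simp only [Finset.mem_range] at ha hb
    push_cast at hab
    have h1 := hu.mul_right_cancel (add_left_cancel hab)
    have h2 := (ZMod.natCast_eq_natCast_iff' _ _ _).1 h1
    rwa [Nat.mod_eq_of_lt ha, Nat.mod_eq_of_lt hb] at h2
  · intro y _
    obtain ⟨v, hv⟩ := hu
    refine ⟨((y - r) * (v⁻¹ : (ZMod n)ˣ) : ZMod n).val, ?_, ?_⟩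
    · simp [ZMod.val_lt]
    · push_cast
      rw [ZMod.natCast_zmod_val, ← hv, mul_assoc]
      simp

lemma aux_per {M : Type*} (n : ℕ) (w : ℕ → M) (hw : ∀ u, w (u + n) = w u) (u : ℕ) :
    w (u % n) = w u := by
  have h : ∀ k v, w (v + n * k) = w v := by
    intro k
    induction k with
    | zero => simp
    | succ k ih => intro v; rw [Nat.mul_succ, ← add_assoc, hw, ih]
  conv_rhs => rw [← Nat.mod_add_div u n]
  rw [h]

open Finset in
lemma aux_sum_lin {M : Type*} [AddCommMonoid M] (n m r : ℕ) [NeZero n] (hm : Nat.Coprime m n)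
    (w : ℕ → M) (hw : ∀ u, w (u + n) = w u) :
    ∑ t ∈ range n, w (r + t * m) = ∑ t ∈ range n, w t := by
  have h1 := aux_sum_zmod n m r hm (fun y => w y.val)
  have h2 := aux_sum_zmod n 1 0 (by simp) (fun y => w y.val)
  simp only [ZMod.val_natCast, aux_per n w hw] at h1 h2
  rw [h1, ← h2]
  simp

open Finset in
lemma aux_root {K : Type*} [Field K] (n : ℕ) [NeZero n] (s : ℕ → K) (hs : ∀ u, s (u + n) = s u)
    (γ : K) (hγ : γ ^ n = 1) (L : ℕ) (d : ℕ → K)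
    (hrec : ∀ u, s (u + L) + ∑ j ∈ range L, d j * s (u + j) = 0)
    (hne : ∑ u ∈ range n, s u * γ ^ u ≠ 0) :
    (γ⁻¹) ^ L + ∑ j ∈ range L, d j * (γ⁻¹) ^ j = 0 := by
  have hγ0 : γ ≠ 0 := by
    rintro rfl
    rw [zero_pow (NeZero.ne n)] at hγ
    exact zero_ne_one hγ
  have key : ∀ m, ∑ u ∈ range n, s (u + m) * γ ^ u
      = (γ⁻¹) ^ m * ∑ u ∈ range n, s u * γ ^ u := by
    intro m
    have := aux_sum_lin n 1 m (by simp) (fun u => s u * γ ^ u)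
      (fun u => by simp only [hs, pow_add, hγ, mul_one])
    rw [← this, Finset.mul_sum]
    refine Finset.sum_congr rfl fun u _ => ?_
    rw [mul_one, add_comm u m, pow_add]
    have hh : (γ⁻¹) ^ m * γ ^ m = 1 := by rw [← mul_pow, inv_mul_cancel₀ hγ0, one_pow]
    linear_combination (-(s (m + u) * γ ^ u)) * hh
  have h0 : ∑ u ∈ range n, (s (u + L) + ∑ j ∈ range L, d j * s (u + j)) * γ ^ u = 0 :=
    Finset.sum_eq_zero fun u _ => by rw [hrec, zero_mul]
  simp only [add_mul, Finset.sum_add_distrib, Finset.sum_mul] at h0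
  rw [Finset.sum_comm, key] at h0
  have h1 : ∀ j ∈ range L, ∑ u ∈ range n, d j * s (u + j) * γ ^ u
      = (d j * (γ⁻¹) ^ j) * ∑ u ∈ range n, s u * γ ^ u := by
    intro j _
    rw [mul_assoc, ← key, Finset.mul_sum]
    exact Finset.sum_congr rfl fun u _ => by ring
  rw [Finset.sum_congr rfl h1, ← Finset.sum_mul, ← add_mul] at h0
  exact (mul_eq_zero.1 h0).resolve_right hne

open Finset in
lemma aux_unit_sum {K : Type*} [Field K] (p q : ℕ) (hp : p.Prime) (hq : q.Prime) (hne : p ≠ q)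
    (γ : K) (hγ : γ ^ (p * q) = 1) (hγp : γ ^ p ≠ 1) (hγq : γ ^ q ≠ 1) :
    ∑ u ∈ range (p * q), (if p ∣ u ∨ q ∣ u then (0 : K) else 1) * γ ^ u = 1 := by
  have : NeZero (p * q) := ⟨mul_ne_zero hp.ne_zero hq.ne_zero⟩
  have hcop : Nat.Coprime p q := (Nat.coprime_primes hp hq).2 hne
  have zero : ∀ m, m ∣ p * q → γ ^ m ≠ 1 →
      ∑ u ∈ range (p * q), (if m ∣ u then (1 : K) else 0) * γ ^ u = 0 := by
    intro m hm hγm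
    have := aux_sum_lin (p * q) 1 m (by simp) (fun u => (if m ∣ u then (1 : K) else 0) * γ ^ u)
      (fun u => by simp only [pow_add, hγ, mul_one, (Nat.dvd_add_left hm)])
    simp only [mul_one, Nat.dvd_add_right (dvd_refl m), pow_add] at this
    have h2 : (γ ^ m - 1) * ∑ u ∈ range (p * q), (if m ∣ u then (1 : K) else 0) * γ ^ u = 0 := by
      rw [sub_mul, one_mul]
      nth_rewrite 2 [← this]
      rw [Finset.mul_sum, sub_eq_zero]
      exact Finset.sum_congr rfl fun u _ => by ring
    exact (mul_eq_zero.1 h2).resolve_left (sub_ne_zero.2 hγm)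
  have z1 := zero 1 (one_dvd _) (by
    rintro h
    rw [pow_one] at h
    exact hγp (by rw [h, one_pow]))
  have zp := zero p (dvd_mul_right _ _) hγp
  have zq := zero q (dvd_mul_left _ _) hγq
  have e : ∑ u ∈ range (p * q), (if p * q ∣ u then (1 : K) else 0) * γ ^ u = 1 := by
    rw [Finset.sum_eq_single 0]
    · simp
    · intro u hu hu0
      rw [if_neg, zero_mul]
      intro hd
      exact absurd (Nat.le_of_dvd (Nat.pos_of_ne_zero hu0) hd) (by simpa using hu)
    · intro h
      exact absurd (Finset.mem_range.2 (Nat.pos_of_ne_zero (NeZero.ne (p * q)))) h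
  have : ∀ u, (if p ∣ u ∨ q ∣ u then (0 : K) else 1) * γ ^ u
      = (if 1 ∣ u then (1 : K) else 0) * γ ^ u - (if p ∣ u then (1 : K) else 0) * γ ^ u
        - (if q ∣ u then (1 : K) else 0) * γ ^ u + (if p * q ∣ u then (1 : K) else 0) * γ ^ u := by
    intro u
    have hpq : p * q ∣ u ↔ p ∣ u ∧ q ∣ u := by
      constructor
      · intro h
        exact ⟨(dvd_mul_right _ _).trans h, (dvd_mul_left _ _).trans h⟩
      · rintro ⟨h1, h2⟩
        exact hcop.mul_dvd_of_dvd_of_dvd h1 h2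
    by_cases h1 : p ∣ u <;> by_cases h2 : q ∣ u <;> simp [h1, h2, hpq]
  simp only [this, Finset.sum_add_distrib, Finset.sum_sub_distrib, z1, zp, zq, e]
  simp

lemma aux_sum4 (m : ℕ) : ∑ k ∈ Finset.range (4 * m), (k : ZMod 4) = 2 * m := by
  induction m with
  | zero => simp
  | succ m ih =>
    rw [show 4 * (m + 1) = 4 * m + 1 + 1 + 1 + 1 by ring]
    simp only [Finset.sum_range_succ, ih]
    push_cast
    have : (4 : ZMod 4) = 0 := by decide
    simp only [this]
    ring_nf
    have h6 : (6 : ZMod 4) = 2 := by decide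
    rw [h6]

/-- structure of the sequence -/
lemma aux_struct
    (p q : ℕ) (hp : Nat.Prime p) (hq : Nat.Prime q) (hne : p ≠ q)
    (hgcd : Nat.gcd (p - 1) (q - 1) = 4)
    (e : ℕ) (he : e = (p - 1) * (q - 1) / 4)
    (g h : ℕ)
    (hgp : orderOf (g : ZMod p) = p - 1)
    (hgq : orderOf (g : ZMod q) = q - 1)
    (hhp : (h : ZMod p) = (g : ZMod p))
    (hhq : (h : ZMod q) = 1)
    (D : ℕ → Finset (ZMod (p * q)))
    (hD : ∀ i, D i = (Finset.range (e / 4) ×ˢ Finset.range 4).image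
        (fun sj => (g : ZMod (p * q)) ^ (4 * sj.1 + i) * (h : ZMod (p * q)) ^ sj.2))
    (E : ℕ → ZMod 4)
    (hED : ∀ u : ℕ, ∀ i < 4, (u : ZMod (p * q)) ∈ D i → E u = (i : ZMod 4))
    (u : ℕ) (hu : ¬ p ∣ u) (b : ℕ) (hb : (u : ZMod q) = (g : ZMod q) ^ b) :
    E u = b := by
  have := Fact.mk hp
  have := Fact.mk hq
  have hcop : Nat.Coprime p q := (Nat.coprime_primes hp hq).2 hne
  have : NeZero (p - 1) := ⟨by have := hp.two_le; omega⟩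
  have hu0 : (u : ZMod p) ≠ 0 := by rwa [Ne, ZMod.natCast_eq_zero_iff]
  obtain ⟨a, -, ha⟩ := (hgp ▸ IsPrimitiveRoot.orderOf (g : ZMod p) :
    IsPrimitiveRoot (g : ZMod p) (p - 1)).eq_pow_of_pow_eq_one
      (ZMod.pow_card_sub_one_eq_one hu0)
  have h4p : 4 ∣ p - 1 := hgcd ▸ Nat.gcd_dvd_left _ _
  have h4q : 4 ∣ q - 1 := hgcd ▸ Nat.gcd_dvd_right _ _
  have hp1 : p - 1 ≠ 0 := NeZero.ne _
  have hq1 : q - 1 ≠ 0 := by have := hq.two_le; omega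
  have hlcm : Nat.lcm (p - 1) (q - 1) = e := by rw [he, Nat.lcm, hgcd]
  -- choose `j`
  set j := (a + 3 * b) % 4 with hj
  have hcompat : (a + (p - 1) * j - j) ≡ b [MOD Nat.gcd (p - 1) (q - 1)] := by
    rw [hgcd]
    obtain ⟨m, hm⟩ := h4p
    have hm0 : m ≠ 0 := by rintro rfl; simp at hm; omega
    have : j ≤ m * j := Nat.le_mul_of_pos_left _ (Nat.pos_of_ne_zero hm0)
    rw [hm, mul_assoc]
    unfold Nat.ModEq
    omega
  obtain ⟨x, hx1, hx2⟩ := Nat.chineseRemainder' hcompat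
  have hjle : j ≤ (p - 1) * j := Nat.le_mul_of_pos_left _ (Nat.pos_of_ne_zero hp1)
  set y := x % e with hy
  have he0 : 0 < e := by
    rw [← hlcm]; exact Nat.lcm_pos (Nat.pos_of_ne_zero hp1) (Nat.pos_of_ne_zero hq1)
  have hylt : y < e := Nat.mod_lt _ he0
  have hyx : y ≡ x [MOD e] := Nat.mod_modEq _ _
  have hy1 : y + j ≡ a [MOD (p - 1)] := by
    have h1 : y ≡ a + (p - 1) * j - j [MOD (p - 1)] :=
      (hyx.of_dvd (hlcm ▸ Nat.dvd_lcm_left _ _)).trans hx1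
    have h2 := h1.add_right j
    rw [Nat.sub_add_cancel (by omega)] at h2
    exact h2.trans (by simp [Nat.ModEq])
  have hy2 : y ≡ b [MOD (q - 1)] := (hyx.of_dvd (hlcm ▸ Nat.dvd_lcm_right _ _)).trans hx2
  have hyb : y % 4 = b % 4 := hy2.of_dvd h4q
  have h4e : 4 ∣ e := hlcm ▸ h4p.trans (Nat.dvd_lcm_left _ _)
  have hmem : (u : ZMod (p * q)) ∈ D (b % 4) := by
    rw [hD, Finset.mem_image]
    refine ⟨(y / 4, j), ?_, ?_⟩
    · simp only [Finset.mem_product, Finset.mem_range]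
      omega
    · simp only
      rw [show 4 * (y / 4) + b % 4 = y by omega]
      have hc : ((g ^ y * h ^ j : ℕ) : ZMod (p * q)) = (u : ZMod (p * q)) := by
        rw [ZMod.natCast_eq_natCast_iff, ← Nat.modEq_and_modEq_iff_modEq_mul hcop,
          ← ZMod.natCast_eq_natCast_iff, ← ZMod.natCast_eq_natCast_iff]
        push_cast
        rw [hhp, hhq, one_pow, mul_one, hb, ← pow_add, ← ha]
        constructor
        · rw [← pow_mod_orderOf, hgp, hy1, ← hgp, pow_mod_orderOf]
        · rw [← pow_mod_orderOf, hgq, hy2, ← hgq, pow_mod_orderOf]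
      rw [← hc]; push_cast; rfl
  rw [hED u _ (Nat.mod_lt _ (by norm_num)) hmem]
  exact ZMod.natCast_mod b 4

lemma aux_coreA (p q : ℕ) (hp : Nat.Prime p) (hq : Nat.Prime q) (hne : p ≠ q)
    (hp4 : p % 4 = 1) (F : ZMod q → ZMod 4) (E : ℕ → ZMod 4)
    (hEF : ∀ u : ℕ, E u = if q ∣ u then 2 else if p ∣ u then 0 else F u) (r : ℕ) :
    ∑ t ∈ Finset.range p, E (r + t * q) = 2 * (if q ∣ r then 1 else 0) := by
  have := Fact.mk hp
  have hcop : Nat.Coprime q p := (Nat.coprime_primes hq hp).2 hne.symm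
  have hp4' : (p : ZMod 4) = 1 := by
    rw [← ZMod.natCast_mod, hp4]; rfl
  have hd : ∀ t, q ∣ r + t * q ↔ q ∣ r := fun t => Nat.dvd_add_left (dvd_mul_left _ _)
  by_cases hr : q ∣ r
  · simp [hEF, hd, hr, hp4']
  · have h1 := aux_sum_zmod p q r hcop (fun y => if y = 0 then (0 : ZMod 4) else F r)
    simp only [ZMod.natCast_eq_zero_iff] at h1
    simp only [hEF, hd, hr, if_false]
    have h2 : ∀ t, F ((r + t * q : ℕ) : ZMod q) = F r := fun t => by simp
    simp only [h2, h1, mul_zero]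
    have h3 : ∀ y : ZMod p, (if y = 0 then (0 : ZMod 4) else F r)
        = F r - (if y = 0 then F r else 0) := by
      intro y; by_cases hy : y = 0 <;> simp [hy]
    simp [h3, hp4']

lemma aux_coreF (q : ℕ) (hq : Nat.Prime q) (hq8 : q % 8 = 5) (g : ℕ)
    (hgq : orderOf (g : ZMod q) = q - 1) (F : ZMod q → ZMod 4)
    (F0 : F 0 = 2) (Fpow : ∀ k : ℕ, F ((g : ZMod q) ^ k) = k) [Fintype (ZMod q)] :
    ∑ x : ZMod q, F x = 0 := by
  classical
  have := Fact.mk hq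
  have hprim : IsPrimitiveRoot (g : ZMod q) (q - 1) := hgq ▸ IsPrimitiveRoot.orderOf _
  have : NeZero (q - 1) := ⟨by omega⟩
  have himg : (Finset.univ.erase (0 : ZMod q))
      = (Finset.range (q - 1)).image (fun k => (g : ZMod q) ^ k) := by
    ext x
    simp only [Finset.mem_erase, Finset.mem_univ, and_true, Finset.mem_image, Finset.mem_range]
    constructor
    · intro hx
      exact hprim.eq_pow_of_pow_eq_one (ZMod.pow_card_sub_one_eq_one hx)
    · rintro ⟨k, -, rfl⟩
      exact pow_ne_zero _ (hprim.ne_zero (NeZero.ne _))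
  rw [← Finset.add_sum_erase _ _ (Finset.mem_univ (0 : ZMod q)), himg, Finset.sum_image, F0]
  · simp only [Fpow]
    obtain ⟨l, hl⟩ : ∃ l, q - 1 = 4 * (2 * l + 1) := ⟨q / 8, by omega⟩
    rw [hl, aux_sum4]
    push_cast
    have : (4 : ZMod 4) = 0 := by decide
    linear_combination ((l : ZMod 4) + 1) * this
  · intro a ha b hb hab
    exact hprim.pow_inj (by simpa using ha) (by simpa using hb) hab

lemma aux_coreB (p q : ℕ) (hp : Nat.Prime p) (hq : Nat.Prime q) (hne : p ≠ q)
    (hq8 : q % 8 = 5) (g : ℕ)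
    (hgq : orderOf (g : ZMod q) = q - 1) (F : ZMod q → ZMod 4)
    (F0 : F 0 = 2) (Fpow : ∀ k : ℕ, F ((g : ZMod q) ^ k) = k) (E : ℕ → ZMod 4)
    (hEF : ∀ u : ℕ, E u = if q ∣ u then 2 else if p ∣ u then 0 else F u) (r : ℕ) :
    ∑ t ∈ Finset.range q, E (r + t * p) = 2 * (if p ∣ r then 1 else 0) := by
  have := Fact.mk hq
  have hcop : Nat.Coprime p q := (Nat.coprime_primes hp hq).2 hne
  have hd : ∀ t, p ∣ r + t * p ↔ p ∣ r := fun t => Nat.dvd_add_left (dvd_mul_left _ _)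
  by_cases hr : p ∣ r
  · have h1 := aux_sum_zmod q p r hcop (fun y => if y = 0 then (2 : ZMod 4) else 0)
    simp only [ZMod.natCast_eq_zero_iff] at h1
    simp only [hEF, hd, hr, if_true, h1]
    simp
  · have h1 := aux_sum_zmod q p r hcop F
    rw [aux_coreF q hq hq8 g hgq F F0 Fpow] at h1
    simp only [hr, if_false, mul_zero]
    rw [← h1]
    refine Finset.sum_congr rfl fun t _ => ?_
    rw [hEF]
    by_cases hqd : q ∣ r + t * p
    · rw [if_pos hqd, (ZMod.natCast_eq_zero_iff _ _).2 hqd, F0]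
    · rw [if_neg hqd, if_neg (by rwa [hd])]

lemma aux_two_mul (x : ZMod 4) : 2 * x = 0 → x = 0 ∨ x = 2 := by
  revert x; decide

open Finset in
lemma aux_recsum (E : ℕ → ZMod 4) (L : ℕ) (d : ℕ → ZMod 4)
    (hrec : ∀ u, E (u + L) + ∑ j ∈ range L, d j * E (u + j) = 0) (n m : ℕ) (a : ℕ → ZMod 4)
    (ha : ∀ r, ∑ t ∈ range n, E (r + t * m) = 2 * a r)
    {K : Type*} [CommRing K] (ψ : ZMod 4 →+* K) (hψ : ψ 2 = 0) (u : ℕ) :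
    ψ (a (u + L)) + ∑ j ∈ range L, ψ (d j) * ψ (a (u + j)) = 0 := by
  have h1 : 2 * (a (u + L) + ∑ j ∈ range L, d j * a (u + j)) = 0 := by
    have h2 : ∑ t ∈ range n, (E (u + t * m + L) + ∑ j ∈ range L, d j * E (u + t * m + j)) = 0 :=
      Finset.sum_eq_zero fun t _ => hrec _
    rw [Finset.sum_add_distrib, Finset.sum_comm] at h2
    simp only [← Finset.mul_sum, add_right_comm u, ha] at h2
    rw [mul_add, Finset.mul_sum, ← h2]
    congr 1
    exact Finset.sum_congr rfl fun j _ => by ring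
  have h3 : ψ (a (u + L) + ∑ j ∈ range L, d j * a (u + j)) = 0 := by
    rcases aux_two_mul _ h1 with h | h <;> rw [h]
    · simp
    · exact hψ
  simpa using h3

open Finset in
lemma aux_theta (p q : ℕ) (hp : Nat.Prime p) (hq : Nat.Prime q) (hne : p ≠ q)
    (hpo : Odd p) (hqo : Odd q)
    (hq8 : q % 8 = 5) (g : ℕ)
    (hgq : orderOf (g : ZMod q) = q - 1) (F : ZMod q → ZMod 4)
    (Fpow : ∀ k : ℕ, F ((g : ZMod q) ^ k) = k) (E : ℕ → ZMod 4)
    (hEF : ∀ u : ℕ, E u = if q ∣ u then 2 else if p ∣ u then 0 else F u)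
    (hper : ∀ u, E (u + p * q) = E u)
    {K : Type*} [Field K] [CharP K 2] (ψ : ZMod 4 →+* K) (γ : K)
    (hγ : γ ^ (p * q) = 1) (hγp : γ ^ p ≠ 1) (hγq : γ ^ q ≠ 1) :
    ∑ u ∈ range (p * q), ψ (E u) * γ ^ u ≠ 0 := by
  have := Fact.mk hp
  have := Fact.mk hq
  have : NeZero (p * q) := ⟨mul_ne_zero hp.ne_zero hq.ne_zero⟩
  have : NeZero (q - 1) := ⟨by omega⟩
  have hprim : IsPrimitiveRoot (g : ZMod q) (q - 1) := hgq ▸ IsPrimitiveRoot.orderOf _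
  have h2K : (2 : K) = 0 := CharTwo.two_eq_zero
  have h2p : Nat.Coprime 2 p := Nat.coprime_two_left.2 hpo
  have h2q : Nat.Coprime 2 q := Nat.coprime_two_left.2 hqo
  have hcop2 : Nat.Coprime 2 (p * q) := Nat.Coprime.mul_right h2p h2q
  have hdp : ∀ u, p ∣ u * 2 ↔ p ∣ u := fun u => h2p.symm.dvd_mul_right
  have hdq : ∀ u, q ∣ u * 2 ↔ q ∣ u := fun u => h2q.symm.dvd_mul_right
  have hψsq : ∀ x, ψ x ^ 2 = ψ x := by
    intro x
    have hx : x ^ 2 = x ∨ x ^ 2 = x + 2 := by revert x; decide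
    rw [← map_pow]
    rcases hx with h | h <;> rw [h]
    rw [map_add, map_ofNat, h2K, add_zero]
  obtain ⟨m, hm1, hm⟩ := hprim.eq_pow_of_pow_eq_one (ξ := (2 : ZMod q))
    (ZMod.pow_card_sub_one_eq_one (by
      intro h
      have h' : ((2 : ℕ) : ZMod q) = 0 := by exact_mod_cast h
      rw [ZMod.natCast_eq_zero_iff] at h'
      have := Nat.le_of_dvd (by norm_num) h'
      omega))
  have hmo : Odd m := by
    by_contra hc
    rw [Nat.not_odd_iff_even] at hc
    have hs : IsSquare (2 : ZMod q) := hm ▸ hc.isSquare_pow _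
    rw [ZMod.exists_sq_eq_two_iff (by omega)] at hs
    omega
  have hψm : ψ (m : ZMod 4) = 1 := by
    obtain ⟨l, rfl⟩ := hmo
    rw [map_natCast]; push_cast; rw [h2K]; ring
  have hdbl : ∀ u, ψ (E (u * 2)) - ψ (E u) = if p ∣ u ∨ q ∣ u then 0 else 1 := by
    intro u
    rw [hEF, hEF u]
    simp only [hdp, hdq]
    by_cases h1 : q ∣ u
    · simp [h1]
    by_cases h2 : p ∣ u
    · simp [h1, h2]
    simp only [h1, h2, if_false, or_self]
    obtain ⟨k, -, hk⟩ := hprim.eq_pow_of_pow_eq_one (ξ := (u : ZMod q))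
      (ZMod.pow_card_sub_one_eq_one (by rwa [Ne, ZMod.natCast_eq_zero_iff]))
    push_cast
    rw [← hm, ← hk, ← pow_add, Fpow, Fpow]
    push_cast
    rw [map_add, hψm]
    ring
  intro h0
  have hsq : ∑ u ∈ range (p * q), ψ (E u) * γ ^ (u * 2) = 0 := by
    have h1 := sum_pow_char (p := 2) (range (p * q)) (fun u => ψ (E u) * γ ^ u)
    rw [h0] at h1
    simp only [mul_pow, hψsq, ← pow_mul] at h1
    rw [← h1]; simp
  have hre := aux_sum_lin (p * q) 2 0 hcop2 (fun u => ψ (E u) * γ ^ u)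
    (fun u => by simp only [hper, pow_add, hγ, mul_one])
  have hre2 := aux_sum_lin (p * q) 2 0 hcop2
    (fun u => (if p ∣ u ∨ q ∣ u then (0 : K) else 1) * γ ^ u)
    (fun u => by
      simp only [pow_add, hγ, mul_one, Nat.dvd_add_left (dvd_mul_right p q),
        Nat.dvd_add_left (dvd_mul_left q p)])
  simp only [zero_add, hdp, hdq] at hre hre2
  rw [aux_unit_sum p q hp hq hne γ hγ hγp hγq] at hre2
  rw [h0] at hre
  have hfin := Finset.sum_sub_distrib (s := range (p * q))
    (fun u => ψ (E (u * 2)) * γ ^ (u * 2)) (fun u => ψ (E u) * γ ^ (u * 2))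
  simp only [← sub_mul, hdbl] at hfin
  rw [hre2, hre, hsq, sub_zero] at hfin
  exact one_ne_zero hfin

open Finset in
lemma aux_main (p q : ℕ) (hp : Nat.Prime p) (hq : Nat.Prime q) (hne : p ≠ q)
    (hpo : Odd p) (hqo : Odd q)
    (hq8 : q % 8 = 5) (hp4 : p % 4 = 1) (g : ℕ)
    (hgq : orderOf (g : ZMod q) = q - 1) (F : ZMod q → ZMod 4)
    (F0 : F 0 = 2) (Fpow : ∀ k : ℕ, F ((g : ZMod q) ^ k) = k) (E : ℕ → ZMod 4)
    (hEF : ∀ u : ℕ, E u = if q ∣ u then 2 else if p ∣ u then 0 else F u)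
    (hper : ∀ u, E (u + p * q) = E u) (L : ℕ) (d : ℕ → ZMod 4)
    (hrec : ∀ u, E (u + L) + ∑ j ∈ range L, d j * E (u + j) = 0) : p * q ≤ L := by
  classical
  have := Fact.mk hp
  have := Fact.mk hq
  have : NeZero (p * q) := ⟨mul_ne_zero hp.ne_zero hq.ne_zero⟩
  have : NeZero p := ⟨hp.ne_zero⟩
  have : NeZero q := ⟨hq.ne_zero⟩
  let K := AlgebraicClosure (ZMod 2)
  have hK : CharP K 2 := charP_of_injective_algebraMap (algebraMap (ZMod 2) K).injective 2
  have h2K : (2 : K) = 0 := CharTwo.two_eq_zero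
  let ψ : ZMod 4 →+* K := ZMod.castHom (by norm_num : 2 ∣ 4) K
  have hψ2 : ψ 2 = 0 := by rw [map_ofNat, h2K]
  have hnK : NeZero ((p * q : ℕ) : K) := ⟨by
    rw [Ne, CharP.cast_eq_zero_iff K 2]
    exact (Nat.odd_mul.2 ⟨hpo, hqo⟩).not_two_dvd_nat⟩
  obtain ⟨ζ, hζ⟩ := HasEnoughRootsOfUnity.exists_primitiveRoot K (p * q)
  let P : Polynomial K := Polynomial.X ^ L +
    ∑ j ∈ range L, Polynomial.C (ψ (d j)) * Polynomial.X ^ j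
  have hdeg : (∑ j ∈ range L, Polynomial.C (ψ (d j)) * Polynomial.X ^ j).degree < (L : WithBot ℕ) := by
    rw [← Polynomial.mem_degreeLT]
    refine Submodule.sum_mem _ fun j hj => ?_
    rw [Polynomial.mem_degreeLT]
    exact (Polynomial.degree_C_mul_X_pow_le _ _).trans_lt (by exact_mod_cast mem_range.1 hj)
  have hP0 : P ≠ 0 := (Polynomial.monic_X_pow_add hdeg).ne_zero
  have hPdeg : P.natDegree = L := by
    apply Polynomial.natDegree_eq_of_degree_eq_some
    rw [Polynomial.degree_add_eq_left_of_degree_lt (by rwa [Polynomial.degree_X_pow]),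
      Polynomial.degree_X_pow]
  have hroot : ∀ γ : K, γ ^ (p * q) = 1 →
      (γ⁻¹) ^ L + ∑ j ∈ range L, ψ (d j) * (γ⁻¹) ^ j = 0 := by
    intro γ hγ
    have hsingle : ∀ n, n ≠ 0 → ∑ u ∈ range n, ψ (if n ∣ u then 1 else 0) * γ ^ u ≠ 0 := by
      intro n hn
      rw [Finset.sum_eq_single 0]
      · simp
      · intro u hu hu0
        rw [if_neg, map_zero, zero_mul]
        intro hd
        exact absurd (Nat.le_of_dvd (Nat.pos_of_ne_zero hu0) hd) (by simpa using hu)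
      · intro h
        exact absurd (Finset.mem_range.2 (Nat.pos_of_ne_zero hn)) h
    by_cases hγq : γ ^ q = 1
    · exact aux_root q (fun u => ψ (if q ∣ u then 1 else 0)) (fun u => by simp) γ hγq L
        (fun j => ψ (d j)) (aux_recsum E L d hrec p q (fun u => if q ∣ u then 1 else 0)
          (aux_coreA p q hp hq hne hp4 F E hEF) ψ hψ2) (hsingle q hq.ne_zero)
    by_cases hγp : γ ^ p = 1
    · exact aux_root p (fun u => ψ (if p ∣ u then 1 else 0)) (fun u => by simp) γ hγp L
        (fun j => ψ (d j)) (aux_recsum E L d hrec q p (fun u => if p ∣ u then 1 else 0)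
          (aux_coreB p q hp hq hne hq8 g hgq F F0 Fpow E hEF) ψ hψ2) (hsingle p hp.ne_zero)
    · refine aux_root (p * q) (fun u => ψ (E u)) (fun u => by simp only [hper]) γ hγ L
        (fun j => ψ (d j)) (fun u => ?_)
        (aux_theta p q hp hq hne hpo hqo hq8 g hgq F Fpow E hEF hper ψ γ hγ hγp hγq)
      simpa using congrArg ψ (hrec u)
  have hsub : Polynomial.nthRootsFinset (p * q) (1 : K) ⊆ P.roots.toFinset := by
    intro β hβ
    rw [Polynomial.mem_nthRootsFinset (Nat.pos_of_ne_zero (NeZero.ne _))] at hβ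
    rw [Multiset.mem_toFinset, Polynomial.mem_roots hP0]
    have := hroot β⁻¹ (by rw [inv_pow, hβ, inv_one])
    have hii : (β⁻¹)⁻¹ = β := inv_inv β
    rw [hii] at this
    change Polynomial.eval β (Polynomial.X ^ L +
      ∑ j ∈ range L, Polynomial.C (ψ (d j)) * Polynomial.X ^ j) = 0
    simp only [Polynomial.eval_add, Polynomial.eval_finset_sum,
      Polynomial.eval_mul, Polynomial.eval_C, Polynomial.eval_pow, Polynomial.eval_X]
    exact this
  calc p * q = (Polynomial.nthRootsFinset (p * q) (1 : K)).card := hζ.card_nthRootsFinset.symm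
    _ ≤ P.roots.toFinset.card := Finset.card_le_card hsub
    _ ≤ Multiset.card P.roots := Multiset.toFinset_card_le _
    _ ≤ P.natDegree := P.card_roots'
    _ = L := hPdeg


theorem stmt19
    (p q : ℕ) (hp : Nat.Prime p) (hq : Nat.Prime q) (hne : p ≠ q)
    (hpo : Odd p) (hqo : Odd q)
    (hgcd : Nat.gcd (p - 1) (q - 1) = 4)
    (e : ℕ) (he : e = (p - 1) * (q - 1) / 4)
    (g h : ℕ)
    (hgp : orderOf (g : ZMod p) = p - 1)
    (hgq : orderOf (g : ZMod q) = q - 1)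
    (hhp : (h : ZMod p) = (g : ZMod p))
    (hhq : (h : ZMod q) = 1)
    (D : ℕ → Finset (ZMod (p * q)))
    (hD : ∀ i, D i = (Finset.range (e / 4) ×ˢ Finset.range 4).image
        (fun sj => (g : ZMod (p * q)) ^ (4 * sj.1 + i) * (h : ZMod (p * q)) ^ sj.2))
    (Pset Qset : Finset (ZMod (p * q)))
    (hP : Pset = (Finset.Icc 1 (q - 1)).image (fun k => ((k * p : ℕ) : ZMod (p * q))))
    (hQ : Qset = (Finset.Icc 1 (p - 1)).image (fun k => ((k * q : ℕ) : ZMod (p * q))))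
    (E : ℕ → ZMod 4)
    (hE2 : ∀ u : ℕ, ((u : ZMod (p * q)) ∈ Qset ∨ (u : ZMod (p * q)) = 0) → E u = 2)
    (hE0 : ∀ u : ℕ, (u : ZMod (p * q)) ∈ Pset → E u = 0)
    (hED : ∀ u : ℕ, ∀ i < 4, (u : ZMod (p * q)) ∈ D i → E u = (i : ZMod 4))
    (hq8 : q % 8 = 5) (hp4 : p % 4 = 1) :
    IsLeast {L : ℕ | ∃ c : Fin L → ZMod 4,
        ∀ u : ℕ, E (u + L) + ∑ i : Fin L, c i * E (u + L - 1 - i.val) = 0}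
      (p * q) := by
  have := Fact.mk hp
  have := Fact.mk hq
  have hcop : Nat.Coprime p q := (Nat.coprime_primes hp hq).2 hne
  have hprim : IsPrimitiveRoot (g : ZMod q) (q - 1) := hgq ▸ IsPrimitiveRoot.orderOf _
  have : NeZero (q - 1) := ⟨by omega⟩
  have hst := aux_struct p q hp hq hne hgcd e he g h hgp hgq hhp hhq D hD E hED
  obtain ⟨F, F0, Fpow⟩ : ∃ F : ZMod q → ZMod 4, F 0 = 2 ∧
      ∀ k : ℕ, F ((g : ZMod q) ^ k) = k := by
    classical
    refine ⟨fun x => if x = 0 then 2 else E (Nat.chineseRemainder hcop 1 x.val), by simp, ?_⟩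
    intro k
    have hg0 : (g : ZMod q) ^ k ≠ 0 := pow_ne_zero _ (hprim.ne_zero (NeZero.ne _))
    simp only [hg0, if_false]
    obtain ⟨u, h1, h2⟩ := Nat.chineseRemainder hcop 1 ((g : ZMod q) ^ k).val
    refine hst u ?_ k ?_
    · intro hd
      have h3 : 0 ≡ 1 [MOD p] := ((Nat.modEq_zero_iff_dvd.2 hd).symm).trans h1
      have := (Nat.modEq_zero_iff_dvd.1 h3.symm)
      exact hp.one_lt.ne' (Nat.dvd_one.1 this)
    · rw [(ZMod.natCast_eq_natCast_iff _ _ _).2 h2, ZMod.natCast_zmod_val]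
  have hmem : ∀ a b u : ℕ, 0 < a → 0 < b → a ∣ u → ¬ a * b ∣ u →
      (u : ZMod (a * b)) ∈ (Finset.Icc 1 (b - 1)).image
        (fun k => ((k * a : ℕ) : ZMod (a * b))) := by
    rintro a b u ha hb ⟨v, rfl⟩ hnd
    rw [Finset.mem_image]
    have hv : v % b ≠ 0 := fun hv => hnd (Nat.mul_dvd_mul_left a (Nat.dvd_of_mod_eq_zero hv))
    have hv2 := Nat.mod_lt v hb
    refine ⟨v % b, by rw [Finset.mem_Icc]; omega, ?_⟩
    rw [ZMod.natCast_eq_natCast_iff, mul_comm _ a]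
    exact (Nat.mod_modEq v b).mul_left' a
  have hEF : ∀ u : ℕ, E u = if q ∣ u then 2 else if p ∣ u then 0 else F u := by
    intro u
    by_cases h1 : q ∣ u
    · rw [if_pos h1]
      apply hE2
      by_cases h2 : p * q ∣ u
      · exact Or.inr ((ZMod.natCast_eq_zero_iff _ _).2 h2)
      · left
        rw [hQ]
        have h3 := hmem q p u hq.pos hp.pos h1 (by rwa [mul_comm])
        rw [Finset.mem_image] at h3 ⊢
        obtain ⟨k, hk, hk2⟩ := h3
        refine ⟨k, hk, ?_⟩
        rw [ZMod.natCast_eq_natCast_iff] at hk2 ⊢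
        rwa [mul_comm p q]
    rw [if_neg h1]
    by_cases h2 : p ∣ u
    · rw [if_pos h2]
      apply hE0
      rw [hP]
      exact hmem p q u hp.pos hq.pos h2 fun h => h1 ((dvd_mul_left _ _).trans h)
    · rw [if_neg h2]
      obtain ⟨k, -, hk⟩ := hprim.eq_pow_of_pow_eq_one (ξ := (u : ZMod q))
        (ZMod.pow_card_sub_one_eq_one (by rwa [Ne, ZMod.natCast_eq_zero_iff]))
      rw [hst u h2 k hk.symm, ← hk, Fpow]
  have hper : ∀ u, E (u + p * q) = E u := by
    intro u
    rw [hEF, hEF u]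
    simp only [Nat.dvd_add_left (dvd_mul_right p q), Nat.dvd_add_left (dvd_mul_left q p)]
    simp
  have hpq : 0 < p * q := Nat.mul_pos hp.pos hq.pos
  constructor
  · refine ⟨fun i => if i.val = p * q - 1 then -1 else 0, fun u => ?_⟩
    rw [Finset.sum_eq_single (⟨p * q - 1, by omega⟩ : Fin (p * q))]
    · simp only [if_true]
      rw [show u + p * q - 1 - (p * q - 1) = u by omega, hper]
      ring
    · intro i _ hi
      beta_reduce
      rw [if_neg, zero_mul]
      intro h
      exact hi (Fin.ext h)
    · intro h
      exact absurd (Finset.mem_univ _) h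
  · rintro L ⟨c, hc⟩
    refine aux_main p q hp hq hne hpo hqo hq8 hp4 g hgq F F0 Fpow E hEF hper L
      (fun j => if hj : L - 1 - j < L then c ⟨L - 1 - j, hj⟩ else 0) (fun u => ?_)
    rw [← hc u]
    congr 1
    rw [← Finset.sum_range_reflect, Finset.sum_range]
    refine Finset.sum_congr rfl fun i _ => ?_
    have hi := i.2
    have h1 : L - 1 - (L - 1 - i.val) = i.val := by omega
    have h2 : u + (L - 1 - i.val) = u + L - 1 - i.val := by omega
    simp only [h1, h2, hi, dif_pos]
end
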